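/- For every integer n ≥ 1, the graph G_n has no {P₂, P_{2k+1}}-factor. -/

import Mathlib

open SimpleGraph

/-- `l = 2⌊(k-12)/17⌋`. -/
def lP (k : ℕ) : ℕ := 2 * ((k - 12) / 17)

/-- `m = ⌊(2k-l+1)/8⌋`. -/
def mP (k : ℕ) : ℕ := (2 * k - lP k + 1) / 8

/-- `r = 2k+1-l-8m`. -/
def rP (k : ℕ) : ℕ := 2 * k + 1 - lP k - 8 * mP k

/-- The graph `H` on 8 vertices `x₁, …, x₈` (represented by `0, …, 7`): the cycle
`x₁x₂⋯x₈x₁` together with the chords `x₂x₄, x₄x₆, x₆x₈, x₈x₂`; `u = x₁ = 0`, `v = x₅ = 4`. -/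
def Hgraph : SimpleGraph (Fin 8) :=
  SimpleGraph.fromRel (fun a b =>
    b.val = (a.val + 1) % 8 ∨ (a.val % 2 = 1 ∧ b.val = (a.val + 2) % 8))

/-- The vertex type of the graph `T`: `m` disjoint copies of `H` together with a set `R`
of `r` further vertices. -/
abbrev TV (k : ℕ) : Type := (Fin (mP k) × Fin 8) ⊕ Fin (rP k)

/-- Membership in `U ∪ R`, where `U = {uᵢ, vᵢ : 1 ≤ i ≤ m}` consists of the copies of
`u = x₁ = 0` and `v = x₅ = 4`, and `R` is the set of `r` extra vertices. -/
def inUR (k : ℕ) : TV k → Prop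
  | Sum.inl (_, a) => a = 0 ∨ a = 4
  | Sum.inr _ => True

/-- The graph `T`: the disjoint union `H₁ ∪ ⋯ ∪ H_m` together with the vertices of `R`,
where all pairs of distinct vertices of `U ∪ R` are joined. -/
def Tgraph (k : ℕ) : SimpleGraph (TV k) :=
  SimpleGraph.fromRel (fun s t =>
    (match s, t with
      | Sum.inl (i, a), Sum.inl (j, b) => i = j ∧ Hgraph.Adj a b
      | _, _ => False) ∨ (inUR k s ∧ inUR k t))

/-- The vertex type of `Q = L + T` where `L` is a complete graph of order `l`. -/
abbrev QV (k : ℕ) : Type := Fin (lP k) ⊕ TV k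

/-- The graph `Q = L + T`, the join of the complete graph `L` of order `l` with `T`. -/
def Qgraph (k : ℕ) : SimpleGraph (QV k) :=
  SimpleGraph.fromRel (fun x y =>
    match x, y with
    | Sum.inl _, _ => True
    | Sum.inr s, Sum.inr t => (Tgraph k).Adj s t
    | _, _ => False)


/-- The vertex type of `G_n`: a complete graph `Q₀` of order `n` joined to `2n+1` disjoint
copies of `Q`. -/
abbrev GV (k n : ℕ) : Type := Fin n ⊕ (Fin (2 * n + 1) × QV k)

/-- The graph `G_n = Q₀ + (Q₁ ∪ ⋯ ∪ Q_{2n+1})`: the join of a complete graph `Q₀` of order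
`n` with the disjoint union of `2n+1` copies of `Q`. -/
def Ggraph (k n : ℕ) : SimpleGraph (GV k n) :=
  SimpleGraph.fromRel (fun x y =>
    match x, y with
    | Sum.inl _, _ => True
    | Sum.inr (i, s), Sum.inr (j, t) => i = j ∧ (Qgraph k).Adj s t
    | _, _ => False)

/-- `F` is a `{P₂, P_{2k+1}}`-factor of `G`. -/
def IsP2P2k1Factor {V : Type*} (G : SimpleGraph V) (k : ℕ) (F : SimpleGraph V) : Prop :=
  F ≤ G ∧ ∀ C : F.ConnectedComponent,
    Nonempty ((F.induce C.supp) ≃g pathGraph 2) ∨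
    Nonempty ((F.induce C.supp) ≃g pathGraph (2 * k + 1))

theorem card_QV (k : ℕ) : Fintype.card (QV k) = 2 * k + 1 := by
  simp only [Fintype.card_sum, Fintype.card_prod, Fintype.card_fin]
  simp only [rP, mP, lP]
  omega

theorem two_mul_lP_add_two_lt_mP {k : ℕ} (hk : 29 ≤ k) : 2 * lP k + 2 < mP k := by
  simp only [mP, lP]
  omega

theorem Tgraph_adj_copy {k : ℕ} {i : Fin (mP k)} {a : Fin 8} (h0 : a ≠ 0) (h4 : a ≠ 4)
    {t : TV k} (h : (Tgraph k).Adj (Sum.inl (i, a)) t) :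
    ∃ b, t = Sum.inl (i, b) ∧ Hgraph.Adj a b := by
  rcases t with ⟨j, b⟩ | t
  · simp only [Tgraph, SimpleGraph.fromRel_adj, inUR, h0, h4, or_self, false_and, and_false,
      or_false] at h
    rcases h with ⟨-, ⟨rfl, h⟩ | ⟨rfl, h⟩⟩
    · exact ⟨b, rfl, h⟩
    · exact ⟨b, rfl, h.symm⟩
  · simp [Tgraph, SimpleGraph.fromRel_adj, inUR, h0, h4] at h

/-- There is no injective numbering of `H` in which the two numbers adjacent to that of each
vertex other than `u` and `v` belong to neighbours of that vertex. -/
theorem Hgraph_no_numbering (p : Fin 8 → ℕ) (hp : Function.Injective p)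
    (hs : ∀ a, a ≠ 0 → a ≠ 4 → ∃ b, Hgraph.Adj a b ∧ p b = p a + 1)
    (ht : ∀ a, a ≠ 0 → a ≠ 4 → ∃ b, Hgraph.Adj a b ∧ p b + 1 = p a) : False := by
  have s1 := hs 1 (by decide) (by decide)
  have s2 := hs 2 (by decide) (by decide)
  have s3 := hs 3 (by decide) (by decide)
  have s5 := hs 5 (by decide) (by decide)
  have s6 := hs 6 (by decide) (by decide)
  have s7 := hs 7 (by decide) (by decide)
  have t1 := ht 1 (by decide) (by decide)
  have t2 := ht 2 (by decide) (by decide)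
  have t3 := ht 3 (by decide) (by decide)
  have t5 := ht 5 (by decide) (by decide)
  have t6 := ht 6 (by decide) (by decide)
  have t7 := ht 7 (by decide) (by decide)
  simp [Fin.exists_fin_succ, Hgraph, SimpleGraph.fromRel_adj] at s1 s2 s3 s5 s6 s7 t1 t2 t3 t5 t6 t7
  have n16 := hp.ne (show (1 : Fin 8) ≠ 6 by decide)
  have n26 := hp.ne (show (2 : Fin 8) ≠ 6 by decide)
  have n36 := hp.ne (show (3 : Fin 8) ≠ 6 by decide)
  clear hs ht hp
  rcases s2 with s2 | s2 <;> rcases t2 with t2 | t2 <;> omega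

theorem Qgraph_copy_exists_end_or_adj {k : ℕ} {F : SimpleGraph (QV k)} (hF : F ≤ Qgraph k)
    (e : F ≃g pathGraph (2 * k + 1)) (i : Fin (mP k)) :
    ∃ a : Fin 8, (e (Sum.inr (Sum.inl (i, a)))).val = 0 ∨
      (e (Sum.inr (Sum.inl (i, a)))).val = 2 * k ∨
      ∃ y, F.Adj (Sum.inl y) (Sum.inr (Sum.inl (i, a))) := by
  by_contra! h
  have key : ∀ a : Fin 8, a ≠ 0 → a ≠ 4 → ∀ z : Fin (2 * k + 1),
      (pathGraph (2 * k + 1)).Adj (e (Sum.inr (Sum.inl (i, a)))) z →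
      ∃ b, Hgraph.Adj a b ∧ e (Sum.inr (Sum.inl (i, b))) = z := by
    intro a h0 h4 z hz
    obtain ⟨w, rfl⟩ := e.surjective z
    rw [e.map_adj_iff] at hz
    rcases w with y | t
    · exact absurd hz.symm ((h a).2.2 y)
    · have hQ := hF hz
      simp only [Qgraph, SimpleGraph.fromRel_adj] at hQ
      obtain ⟨b, rfl, hb⟩ := Tgraph_adj_copy h0 h4 (hQ.2.elim id fun h => h.symm)
      exact ⟨b, hb, rfl⟩
  refine Hgraph_no_numbering (fun a => (e (Sum.inr (Sum.inl (i, a)))).val) ?_ ?_ ?_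
  · intro a b hab
    simpa using e.injective (Fin.ext hab)
  · intro a h0 h4
    have h1 := (h a).2.1
    have h2 := (e (Sum.inr (Sum.inl (i, a)))).isLt
    obtain ⟨b, hb, hbz⟩ := key a h0 h4 ⟨(e (Sum.inr (Sum.inl (i, a)))).val + 1, by omega⟩
      (by simp [pathGraph_adj])
    exact ⟨b, hb, by simp [hbz]⟩
  · intro a h0 h4
    have h1 := (h a).1
    obtain ⟨b, hb, hbz⟩ := key a h0 h4 ⟨(e (Sum.inr (Sum.inl (i, a)))).val - 1, by omega⟩
      (by simp only [pathGraph_adj]; omega)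
    exact ⟨b, hb, by simp only [hbz]; omega⟩

theorem Qgraph_no_spanning_path {k : ℕ} (hk : 29 ≤ k) {F : SimpleGraph (QV k)}
    (hF : F ≤ Qgraph k) (e : F ≃g pathGraph (2 * k + 1)) : False := by
  choose a ha using Qgraph_copy_exists_end_or_adj hF e
  have ex : ∀ i, ∃ c : (Fin (lP k) × Bool) ⊕ Bool,
      match c with
      | Sum.inr b => (e (Sum.inr (Sum.inl (i, a i)))).val = if b then 2 * k else 0
      | Sum.inl (y, b) => if b
          then (e (Sum.inr (Sum.inl (i, a i)))).val = (e (Sum.inl y)).val + 1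
          else (e (Sum.inr (Sum.inl (i, a i)))).val + 1 = (e (Sum.inl y)).val := by
    intro i
    rcases ha i with h | h | ⟨y, h⟩
    · exact ⟨Sum.inr false, by simpa using h⟩
    · exact ⟨Sum.inr true, by simpa using h⟩
    · rw [← e.map_adj_iff, pathGraph_adj] at h
      rcases h with h | h
      · exact ⟨Sum.inl (y, true), by simpa using h.symm⟩
      · exact ⟨Sum.inl (y, false), by simpa using h⟩
  choose c hc using ex
  have hinj : Function.Injective c := by
    intro i j hij
    have hi := hc i
    have hj := hc j
    rw [← hij] at hj
    have : (e (Sum.inr (Sum.inl (i, a i)))).val = (e (Sum.inr (Sum.inl (j, a j)))).val := by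
      generalize c i = d at hi hj
      rcases d with ⟨y, b⟩ | b
      · cases b <;> simp at hi hj <;> omega
      · simp only at hi hj
        rw [hi, hj]
    have := e.injective (Fin.ext this)
    simp only [Sum.inr.injEq, Sum.inl.injEq, Prod.mk.injEq] at this
    exact this.1
  have := Fintype.card_le_of_injective c hinj
  simp only [Fintype.card_fin, Fintype.card_sum, Fintype.card_prod, Fintype.card_bool] at this
  have := two_mul_lP_add_two_lt_mP hk
  omega

theorem exists_numbering_of_components_paths {V : Type*} {F : SimpleGraph V}
    (h : ∀ C : F.ConnectedComponent, ∃ N, Nonempty (F.induce C.supp ≃g pathGraph N)) :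
    ∃ p : V → ℕ, (∀ a b, F.Adj a b → p a + 1 = p b ∨ p b + 1 = p a) ∧
      ∀ a b c, F.Adj a b → F.Adj a c → p b = p c → b = c := by
  choose N e using h
  let p : V → ℕ := fun v => ((e (F.connectedComponentMk v)).some ⟨v, rfl⟩).val
  have hp : ∀ C v (hv : v ∈ C.supp), p v = ((e C).some ⟨v, hv⟩).val := by
    rintro C v hv
    obtain rfl : F.connectedComponentMk v = C := hv
    rfl
  have hmem : ∀ a b, F.Adj a b → b ∈ (F.connectedComponentMk a).supp := fun a b hab =>
    ConnectedComponent.sound hab.reachable.symm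
  refine ⟨p, fun a b hab => ?_, fun a b c hab hac hbc => ?_⟩
  · rw [hp _ a rfl, hp _ b (hmem a b hab), ← pathGraph_adj, Iso.map_adj_iff]
    exact hab
  · rw [hp _ b (hmem a b hab), hp _ c (hmem a c hac)] at hbc
    simpa using (e _).some.injective (Fin.ext hbc)

theorem Ggraph_adj_copy {k n : ℕ} {i j : Fin (2 * n + 1)} {s t : QV k}
    (h : (Ggraph k n).Adj (Sum.inr (i, s)) (Sum.inr (j, t))) : i = j ∧ (Qgraph k).Adj s t := by
  simp only [Ggraph, SimpleGraph.fromRel_adj] at h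
  rcases h.2 with h | h
  · exact h
  · exact ⟨h.1.symm, h.2.symm⟩

theorem exists_copy_not_adj {k n : ℕ} {F : SimpleGraph (GV k n)}
    (h : ∀ C : F.ConnectedComponent, ∃ N, Nonempty (F.induce C.supp ≃g pathGraph N)) :
    ∃ i, ∀ s q, ¬ F.Adj (Sum.inr (i, s)) (Sum.inl q) := by
  obtain ⟨p, hp, hinj⟩ := exists_numbering_of_components_paths h
  by_contra! hc
  choose s q hsq using hc
  have : Function.Injective fun i => (q i, decide (p (Sum.inr (i, s i)) < p (Sum.inl (q i)))) := by
    intro i j hij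
    simp only [Prod.mk.injEq, decide_eq_decide] at hij
    obtain ⟨h1, h2⟩ := hij
    have hi := hsq i
    have hj := hsq j
    rw [← h1] at h2 hj
    have hi' := hp _ _ hi
    have hj' := hp _ _ hj
    have := hinj _ _ _ hi.symm hj.symm (by omega)
    simp only [Sum.inr.injEq, Prod.mk.injEq] at this
    exact this.1
  have := Fintype.card_le_of_injective _ this
  simp only [Fintype.card_fin, Fintype.card_prod, Fintype.card_bool] at this
  omega

theorem existsUnique_adj_of_iso_pathGraph_two {V : Type*} {F : SimpleGraph V} {v : V}
    (e : F.induce (F.connectedComponentMk v).supp ≃g pathGraph 2) : ∃! w, F.Adj v w := by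
  obtain ⟨z, hz, huniq⟩ : ∃! z, (pathGraph 2).Adj (e ⟨v, rfl⟩) z := by
    generalize e ⟨v, rfl⟩ = x
    refine ⟨x + 1, ?_, fun y => ?_⟩
    · revert x
      simp [pathGraph_two_eq_top]
    · simp only [pathGraph_two_eq_top, top_adj]
      revert x y
      decide
  obtain ⟨w, rfl⟩ := e.surjective z
  refine ⟨w, e.map_adj_iff.1 hz, fun w' hw' => ?_⟩
  have hmem : w' ∈ (F.connectedComponentMk v).supp :=
    ConnectedComponent.sound hw'.reachable.symm
  have := e.injective (huniq (e ⟨w', hmem⟩) (e.map_adj_iff.2 hw'))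
  exact congrArg Subtype.val this

/-- For `k ≥ 29` and every integer `n ≥ 1`, the graph `G_n` has no `{P₂, P_{2k+1}}`-factor. -/
theorem stmt15 (k : ℕ) (hk : 29 ≤ k) (n : ℕ) (hn : 1 ≤ n) :
    ¬ ∃ F, IsP2P2k1Factor (Ggraph k n) k F := by
  rintro ⟨F, hF, hC⟩
  obtain ⟨i, hi⟩ := exists_copy_not_adj fun C =>
    (hC C).elim (fun h => ⟨_, h⟩) fun h => ⟨_, h⟩
  let emb : QV k → GV k n := fun s => Sum.inr (i, s)
  have emb_inj : Function.Injective emb := fun s t h => by simpa [emb] using h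
  have closed : ∀ s y, F.Adj (emb s) y → ∃ t, y = emb t := by
    rintro s (q | ⟨j, t⟩) h
    · exact absurd h (hi s q)
    · obtain ⟨rfl, -⟩ := Ggraph_adj_copy (hF h)
      exact ⟨t, rfl⟩
  have closed' : ∀ s y, F.Reachable (emb s) y → ∃ t, y = emb t := by
    intro s y h
    rw [reachable_iff_reflTransGen] at h
    induction h with
    | refl => exact ⟨s, rfl⟩
    | tail _ h ih =>
      obtain ⟨t, rfl⟩ := ih
      exact closed t _ h
  have hle : F.comap emb ≤ Qgraph k := fun s t h => (Ggraph_adj_copy (hF h)).2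
  by_cases hlong : ∃ s, Nonempty
      (F.induce (F.connectedComponentMk (emb s)).supp ≃g pathGraph (2 * k + 1))
  · obtain ⟨s, ⟨e⟩⟩ := hlong
    have hg : ∀ x : Fin (2 * k + 1), ∃ t, (e.symm x).val = emb t := fun x =>
      closed' s _ (ConnectedComponent.exact (e.symm x).2).symm
    choose g hg using hg
    have g_inj : Function.Injective g := fun x y hxy =>
      e.symm.injective (Subtype.ext (by rw [hg, hg, hxy]))
    have g_bij : Function.Bijective g :=
      (Fintype.bijective_iff_injective_and_card g).2 ⟨g_inj, by rw [card_QV, Fintype.card_fin]⟩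
    let e' : pathGraph (2 * k + 1) ≃g F.comap emb :=
      { Equiv.ofBijective g g_bij with
        map_rel_iff' := by
          intro x y
          rw [← e.symm.map_adj_iff, comap_adj, comap_adj]
          simp only [Equiv.ofBijective_apply, ← hg]
          rfl }
    exact Qgraph_no_spanning_path hk hle e'.symm
  · classical
    have hdeg : ∀ s, (F.comap emb).degree s = 1 := by
      intro s
      rw [degree_eq_one_iff_existsUnique_adj]
      obtain ⟨e⟩ := (hC (F.connectedComponentMk (emb s))).resolve_right fun h => hlong ⟨s, h⟩
      obtain ⟨w, hw, huniq⟩ := existsUnique_adj_of_iso_pathGraph_two e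
      obtain ⟨t, rfl⟩ := closed s w hw
      exact ⟨t, hw, fun t' ht' => emb_inj (huniq _ ht')⟩
    have := (F.comap emb).even_card_odd_degree_vertices
    simp only [hdeg, odd_one, Finset.filter_true, Finset.card_univ, card_QV] at this
    exact absurd this (by simp)
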